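/- Equation for the gauge transform: let T > 0 and let u, g : [0,T] × ℝ → ℝ be smooth, 2π-periodic in x, with ∫₀^{2π} u(t,x) dx = ∫₀^{2π} g(t,x) dx = 0 for every t, and suppose ∂ₜu + H∂ₓ²u + u∂ₓu = g pointwise. Let F(t,·) be the unique smooth 2π-periodic function with ∂ₓF(t,·) = u(t,·) and ∫₀^{2π} F(t,x) dx = 0, define G(t,·) analogously from g, and set W(t,·) = P₊(e^{iF(t,·)/2}). Then, pointwise on [0,T] × ℝ, ∂ₜW − i∂ₓ²W = (i/2)·P₊[ e^{iF/2}·( (1/4π)∫₀^{2π}(∂ₓF(t,y))² dy + G − 2i·P₋∂ₓu ) ]. -/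

import Mathlib

open Real Complex MeasureTheory intervalIntegral

/-- The `k`-th Fourier coefficient `f̂(k) = (1/2π) ∫₀^{2π} f(x) e^{−ikx} dx` of a
(`2π`-periodic) function `f : ℝ → ℂ`. -/
noncomputable def fourierCoef (f : ℝ → ℂ) (k : ℤ) : ℂ :=
  (1 / (2 * π)) * ∫ x in (0:ℝ)..(2 * π), f x * Complex.exp (-Complex.I * k * x)

/-- The Szegő projection onto positive frequencies: `P₊f = Σ_{k≥1} f̂(k) e^{ikx}`. -/
noncomputable def Pplus (f : ℝ → ℂ) (x : ℝ) : ℂ :=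
  ∑' k : ℤ, if 1 ≤ k then fourierCoef f k * Complex.exp (Complex.I * k * x) else 0

/-- The projection onto negative frequencies: `P₋f = Σ_{k≤−1} f̂(k) e^{ikx}`. -/
noncomputable def Pminus (f : ℝ → ℂ) (x : ℝ) : ℂ :=
  ∑' k : ℤ, if k ≤ -1 then fourierCoef f k * Complex.exp (Complex.I * k * x) else 0

/-- The projection onto nonpositive frequencies: `P_{≤0}f = Σ_{k≤0} f̂(k) e^{ikx}`. -/
noncomputable def Pleq0 (f : ℝ → ℂ) (x : ℝ) : ℂ :=
  ∑' k : ℤ, if k ≤ 0 then fourierCoef f k * Complex.exp (Complex.I * k * x) else 0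

/-- The periodic Hilbert transform `(Hf)(x) = Σ_{k∈ℤ} (−i sgn k) f̂(k) e^{ikx}` of a
(`2π`-periodic, smooth) function `f : ℝ → ℂ`; the series converges absolutely for smooth `f`. -/
noncomputable def hilbertC (f : ℝ → ℂ) (x : ℝ) : ℂ :=
  ∑' k : ℤ, (-Complex.I * (Int.sign k : ℂ)) * fourierCoef f k * Complex.exp (Complex.I * k * x)

/-- The periodic Hilbert transform of a real-valued function: for real `f` the series
`Σ_{k∈ℤ} (−i sgn k) f̂(k) e^{ikx}` is real-valued, and we record its real part. -/
noncomputable def hilbertR (f : ℝ → ℝ) (x : ℝ) : ℝ :=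
  (hilbertC (fun y => (f y : ℂ)) x).re

/-- The Fourier multiplier with symbol `m`, acting on functions of period `2π`. -/
noncomputable def fourierMul (m : ℤ → ℂ) (f : ℝ → ℂ) (x : ℝ) : ℂ :=
  ∑' k : ℤ, m k * fourierCoef f k * Complex.exp (Complex.I * k * x)

/-- Smooth complex-valued functions of period `2π`. -/
structure SmoothPeriodic (f : ℝ → ℂ) : Prop where
  contDiff : ContDiff ℝ (⊤ : ℕ∞) f
  periodic : Function.Periodic f (2 * π)

/-- A summable majorant of the Fourier coefficients of a function which, together with its second
derivative, is bounded by `M`. -/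
noncomputable def decayBound (M : ℝ) (k : ℤ) : ℝ :=
  M * (1 / (k : ℝ) ^ 2) + if k = 0 then M else 0

lemma summable_decayBound (M : ℝ) : Summable (decayBound M) :=
  ((Real.summable_one_div_int_pow.2 one_lt_two).mul_left M).add
    (hasSum_ite_eq (0 : ℤ) M).summable

lemma norm_exp_I_mul_int_mul (k : ℤ) (x : ℝ) : ‖Complex.exp (Complex.I * k * x)‖ = 1 := by
  have : Complex.I * k * x = ((k * x : ℝ) : ℂ) * Complex.I := by push_cast; ring
  rw [this, Complex.norm_exp_ofReal_mul_I]

lemma norm_exp_neg_I_mul_int_mul (k : ℤ) (x : ℝ) : ‖Complex.exp (-Complex.I * k * x)‖ = 1 := by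
  simpa using norm_exp_I_mul_int_mul (-k) x

lemma norm_fourierCoef_le {f : ℝ → ℂ} {M : ℝ} (hM : ∀ x ∈ Set.Icc 0 (2 * π), ‖f x‖ ≤ M) (k : ℤ) :
    ‖fourierCoef f k‖ ≤ M := by
  have h := intervalIntegral.norm_integral_le_of_norm_le_const (a := 0) (b := 2 * π) (C := M)
    (f := fun x : ℝ => f x * Complex.exp (-Complex.I * k * x)) (by
      intro x hx
      rw [Set.uIoc_of_le two_pi_pos.le] at hx
      rw [norm_mul, norm_exp_neg_I_mul_int_mul, mul_one]
      exact hM x ⟨hx.1.le, hx.2⟩)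
  rw [sub_zero, abs_of_pos two_pi_pos] at h
  have hn : ‖(1 / (2 * π) : ℂ)‖ = 1 / (2 * π) := by
    have : (1 / (2 * π) : ℂ) = ((1 / (2 * π) : ℝ) : ℂ) := by push_cast; ring
    rw [this, Complex.norm_real, Real.norm_of_nonneg (by positivity)]
  rw [fourierCoef, norm_mul, hn]
  calc 1 / (2 * π) * _ ≤ 1 / (2 * π) * (M * (2 * π)) := by gcongr
    _ = M := by field_simp

lemma hasDerivAt_exp_mul (c : ℂ) (x : ℝ) :
    HasDerivAt (fun y : ℝ => Complex.exp (c * y)) (c * Complex.exp (c * x)) x := by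
  have h : HasDerivAt (fun y : ℝ => c * (y : ℂ)) c x := by
    simpa using (Complex.ofRealCLM.hasDerivAt (x := x)).const_mul c
  simpa [mul_comm] using h.cexp

namespace SmoothPeriodic

variable {f g : ℝ → ℂ}

lemma continuous (hf : SmoothPeriodic f) : Continuous f := hf.contDiff.continuous

lemma hasDerivAt (hf : SmoothPeriodic f) (x : ℝ) : HasDerivAt f (deriv f x) x :=
  (hf.contDiff.differentiable (by simp) x).hasDerivAt

lemma deriv (hf : SmoothPeriodic f) : SmoothPeriodic (deriv f) where
  contDiff := (contDiff_infty_iff_deriv.1 hf.contDiff).2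
  periodic x := by
    rw [← deriv_comp_add_const, show (fun x => f (x + 2 * π)) = f from funext hf.periodic]

lemma intervalIntegrable (hf : SmoothPeriodic f) (k : ℤ) : IntervalIntegrable
    (fun x : ℝ => f x * Complex.exp (-Complex.I * k * x)) volume 0 (2 * π) := by
  have := hf.continuous
  exact Continuous.intervalIntegrable (by fun_prop) _ _

lemma fourierCoef_deriv (hf : SmoothPeriodic f) (k : ℤ) :
    fourierCoef (_root_.deriv f) k = Complex.I * k * fourierCoef f k := by
  have hd : ∀ x ∈ Set.uIcc 0 (2 * π), HasDerivAt
      (fun x : ℝ => f x * Complex.exp (-Complex.I * k * x))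
      (_root_.deriv f x * Complex.exp (-Complex.I * k * x) +
        (-Complex.I * k) * (f x * Complex.exp (-Complex.I * k * x))) x := fun x _ => by
    refine ((hf.hasDerivAt x).mul (hasDerivAt_exp_mul (-Complex.I * k) x)).congr_deriv ?_
    ring
  have hi := hf.deriv.intervalIntegrable k
  have hi' := (hf.intervalIntegrable k).const_mul (-Complex.I * k)
  have h := intervalIntegral.integral_eq_sub_of_hasDerivAt hd (hi.add hi')
  rw [intervalIntegral.integral_add hi hi', intervalIntegral.integral_const_mul] at h
  have he : Complex.exp (-Complex.I * k * ((2 * π : ℝ) : ℂ)) = 1 := by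
    rw [Complex.exp_eq_one_iff]
    exact ⟨-k, by push_cast; ring⟩
  have hp : f (2 * π) = f 0 := by simpa using hf.periodic 0
  rw [he, hp] at h
  simp only [Complex.ofReal_zero, mul_zero, Complex.exp_zero, sub_self] at h
  rw [fourierCoef, fourierCoef]
  linear_combination (1 / (2 * π) : ℂ) * h

lemma norm_fourierCoef_le_decayBound (hf : SmoothPeriodic f) {M : ℝ}
    (h0 : ∀ x ∈ Set.Icc 0 (2 * π), ‖f x‖ ≤ M)
    (h2 : ∀ x ∈ Set.Icc 0 (2 * π), ‖_root_.deriv (_root_.deriv f) x‖ ≤ M) (k : ℤ) :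
    ‖fourierCoef f k‖ ≤ decayBound M k := by
  by_cases hk : k = 0
  · subst hk
    simpa [decayBound] using norm_fourierCoef_le h0 0
  · have h := norm_fourierCoef_le h2 k
    rw [hf.deriv.fourierCoef_deriv, hf.fourierCoef_deriv] at h
    simp only [norm_mul, Complex.norm_I, one_mul, Complex.norm_intCast] at h
    have hk' : (0 : ℝ) < (k : ℝ) ^ 2 := by positivity
    rw [decayBound, if_neg hk, add_zero, mul_one_div, le_div_iff₀ hk', ← sq_abs]
    linarith

lemma exists_bound (hf : SmoothPeriodic f) : ∃ M, ∀ k, ‖fourierCoef f k‖ ≤ decayBound M k := by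
  obtain ⟨A, hA⟩ := isCompact_Icc.exists_bound_of_continuousOn (s := Set.Icc 0 (2 * π))
    hf.continuous.continuousOn
  obtain ⟨B, hB⟩ := isCompact_Icc.exists_bound_of_continuousOn (s := Set.Icc 0 (2 * π))
    hf.deriv.deriv.continuous.continuousOn
  exact ⟨max A B, hf.norm_fourierCoef_le_decayBound
    (fun x hx => (hA x hx).trans (le_max_left _ _)) (fun x hx => (hB x hx).trans (le_max_right _ _))⟩

end SmoothPeriodic

lemma norm_fourierMul_term_le {m : ℤ → ℂ} (hm : ∀ k, ‖m k‖ ≤ 1) {f : ℝ → ℂ} {M : ℝ}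
    {k : ℤ} (hM : ‖fourierCoef f k‖ ≤ decayBound M k) (x : ℝ) :
    ‖m k * fourierCoef f k * Complex.exp (Complex.I * k * x)‖ ≤ decayBound M k := by
  rw [norm_mul, norm_mul, norm_exp_I_mul_int_mul, mul_one]
  calc ‖m k‖ * ‖fourierCoef f k‖ ≤ 1 * decayBound M k := by gcongr; exact hm k
    _ = _ := one_mul _

lemma fourierMul_periodic (m : ℤ → ℂ) (f : ℝ → ℂ) : Function.Periodic (fourierMul m f) (2 * π) := by
  intro x
  rw [fourierMul, fourierMul]
  refine tsum_congr fun k => ?_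
  congr 1
  rw [Complex.exp_eq_exp_iff_exists_int]
  exact ⟨k, by push_cast; ring⟩

lemma fourierMul_const_mul (m : ℤ → ℂ) (c : ℂ) (f : ℝ → ℂ) (x : ℝ) :
    fourierMul m (fun y => c * f y) x = c * fourierMul m f x := by
  rw [fourierMul, fourierMul, ← tsum_mul_left]
  refine tsum_congr fun k => ?_
  simp only [fourierCoef, mul_assoc, intervalIntegral.integral_const_mul]
  ring

namespace SmoothPeriodic

variable {m : ℤ → ℂ} {f g : ℝ → ℂ}

lemma summable_fourierMul (hf : SmoothPeriodic f) (hm : ∀ k, ‖m k‖ ≤ 1) (x : ℝ) :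
    Summable fun k : ℤ => m k * fourierCoef f k * Complex.exp (Complex.I * k * x) := by
  obtain ⟨M, hM⟩ := hf.exists_bound
  exact .of_norm_bounded (summable_decayBound M) fun k => norm_fourierMul_term_le hm (hM k) x

lemma hasDerivAt_fourierMul (hf : SmoothPeriodic f) (hm : ∀ k, ‖m k‖ ≤ 1) (x : ℝ) :
    HasDerivAt (fourierMul m f) (fourierMul m (_root_.deriv f) x) x := by
  obtain ⟨M, hM⟩ := hf.deriv.exists_bound
  refine hasDerivAt_tsum (summable_decayBound M) (fun k y => ?_)
    (fun k y => norm_fourierMul_term_le hm (hM k) y) (hf.summable_fourierMul hm 0) x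
  refine ((hasDerivAt_exp_mul (Complex.I * k) y).const_mul (m k * fourierCoef f k)).congr_deriv ?_
  rw [hf.fourierCoef_deriv]
  ring

lemma fourierCoef_sub (hf : SmoothPeriodic f) (hg : SmoothPeriodic g) (k : ℤ) :
    fourierCoef (fun y => f y - g y) k = fourierCoef f k - fourierCoef g k := by
  simp only [fourierCoef, sub_mul]
  rw [intervalIntegral.integral_sub (hf.intervalIntegrable k) (hg.intervalIntegrable k), mul_sub]

lemma fourierMul_sub (hf : SmoothPeriodic f) (hg : SmoothPeriodic g) (hm : ∀ k, ‖m k‖ ≤ 1)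
    (x : ℝ) :
    fourierMul m (fun y => f y - g y) x = fourierMul m f x - fourierMul m g x := by
  rw [fourierMul, fourierMul, fourierMul,
    ← (hf.summable_fourierMul hm x).tsum_sub (hg.summable_fourierMul hm x)]
  refine tsum_congr fun k => ?_
  rw [hf.fourierCoef_sub hg]
  ring

lemma const_mul (hf : SmoothPeriodic f) (c : ℂ) : SmoothPeriodic fun y => c * f y where
  contDiff := contDiff_const.mul hf.contDiff
  periodic x := congrArg (c * ·) (hf.periodic x)

/-- A smooth periodic function is the sum of its Fourier series. -/
lemma fourierMul_one (hf : SmoothPeriodic f) (x : ℝ) : fourierMul (fun _ => 1) f x = f x := by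
  have : Fact (0 < 2 * π) := ⟨two_pi_pos⟩
  let φ : C(AddCircle (2 * π), ℂ) :=
    ⟨hf.periodic.lift, continuous_coinduced_dom.2 hf.continuous⟩
  have hc (k : ℤ) : fourierCoeff φ k = fourierCoef f k := by
    rw [fourierCoeff_eq_intervalIntegral _ _ 0, fourierCoef, zero_add, Complex.real_smul]
    congr 1
    · push_cast; ring
    · refine intervalIntegral.integral_congr fun y _ => ?_
      change fourier (-k) (y : AddCircle (2 * π)) • f y = _
      rw [fourier_coe_apply, smul_eq_mul, mul_comm]
      congr 2
      push_cast
      have := Complex.ofReal_ne_zero.2 pi_ne_zero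
      field_simp
  have hs : Summable (fourierCoeff φ) := by
    simp_rw [funext hc]
    simpa using hf.summable_fourierMul (m := fun _ => 1) (by simp) 0
  have h := (has_pointwise_sum_fourier_series_of_summable hs (x : AddCircle (2 * π))).tsum_eq
  change _ = f x at h
  rw [← h, fourierMul]
  refine tsum_congr fun k => ?_
  rw [hc, fourier_coe_apply, one_mul, smul_eq_mul]
  congr 2
  push_cast
  have := Complex.ofReal_ne_zero.2 pi_ne_zero
  field_simp

end SmoothPeriodic

lemma Pplus_eq_fourierMul : Pplus = fourierMul fun k => if 1 ≤ k then 1 else 0 := by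
  ext f x
  refine tsum_congr fun k => ?_
  split_ifs with h <;> simp [h]

lemma Pminus_eq_fourierMul : Pminus = fourierMul fun k => if k ≤ -1 then 1 else 0 := by
  ext f x
  refine tsum_congr fun k => ?_
  split_ifs with h <;> simp [h]

lemma hilbertC_eq_fourierMul : hilbertC = fourierMul fun k => -Complex.I * (Int.sign k : ℂ) := rfl

lemma norm_Pplus_symbol_le (k : ℤ) : ‖(if 1 ≤ k then 1 else 0 : ℂ)‖ ≤ 1 := by
  split_ifs <;> simp

lemma norm_Pminus_symbol_le (k : ℤ) : ‖(if k ≤ -1 then 1 else 0 : ℂ)‖ ≤ 1 := by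
  split_ifs <;> simp

lemma norm_hilbert_symbol_le (k : ℤ) : ‖-Complex.I * (Int.sign k : ℂ)‖ ≤ 1 := by
  rcases lt_trichotomy k 0 with h | h | h
  · simp [Int.sign_eq_neg_one_of_neg h]
  · simp [h]
  · simp [Int.sign_eq_one_of_pos h]

lemma fourierCoef_ofReal_neg (f : ℝ → ℝ) (k : ℤ) :
    fourierCoef (fun y => (f y : ℂ)) (-k) =
      (starRingEnd ℂ) (fourierCoef (fun y => (f y : ℂ)) k) := by
  rw [fourierCoef, fourierCoef, map_mul]
  congr 1
  · simp [Complex.conj_ofNat]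
  · rw [intervalIntegral.intervalIntegral_eq_integral_uIoc,
      intervalIntegral.intervalIntegral_eq_integral_uIoc, if_pos two_pi_pos.le, one_smul, one_smul,
      ← integral_conj]
    congr 1
    ext y
    simp [← Complex.exp_conj]

/-- The Hilbert transform of a real-valued function is real-valued. -/
lemma ofReal_hilbertR (f : ℝ → ℝ) (x : ℝ) :
    (hilbertR f x : ℂ) = hilbertC (fun y => (f y : ℂ)) x := by
  rw [hilbertR, ← Complex.conj_eq_iff_re, hilbertC, Complex.conj_tsum,
    ← (Equiv.neg ℤ).tsum_eq]
  refine tsum_congr fun k => ?_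
  simp [fourierCoef_ofReal_neg, ← Complex.exp_conj]

/-- For smooth periodic functions of zero mean, `H f + i f` equals `2 i P₋ f`. -/
lemma SmoothPeriodic.two_I_mul_Pminus {f : ℝ → ℂ} (hf : SmoothPeriodic f)
    (h0 : fourierCoef f 0 = 0) (x : ℝ) :
    2 * Complex.I * Pminus f x = hilbertC f x + Complex.I * f x := by
  rw [← hf.fourierMul_one x, Pminus_eq_fourierMul, hilbertC_eq_fourierMul, fourierMul, fourierMul,
    fourierMul, ← tsum_mul_left, ← tsum_mul_left,
    ← (hf.summable_fourierMul norm_hilbert_symbol_le x).tsum_add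
      ((hf.summable_fourierMul (by simp) x).mul_left _)]
  refine tsum_congr fun k => ?_
  rcases lt_trichotomy k 0 with h | h | h
  · rw [Int.sign_eq_neg_one_of_neg h, if_pos (by omega)]
    push_cast
    ring
  · simp [h, h0]
  · rw [Int.sign_eq_one_of_pos h, if_neg (by omega)]
    push_cast
    ring

/-- A continuous function is bounded on compact time intervals, over one period. -/
lemma exists_bound_closedBall_prod_Icc {E : Type*} [NormedAddCommGroup E] {Φ : ℝ × ℝ → E}
    (hΦ : Continuous Φ) (t : ℝ) :
    ∃ M, ∀ s ∈ Metric.closedBall t 1, ∀ x ∈ Set.Icc 0 (2 * π), ‖Φ (s, x)‖ ≤ M := by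
  obtain ⟨M, hM⟩ := ((isCompact_closedBall t 1).prod
    (isCompact_Icc (a := 0) (b := 2 * π))).exists_bound_of_continuousOn hΦ.continuousOn
  exact ⟨M, fun s hs x hx => hM (s, x) ⟨hs, hx⟩⟩

section TimeDependence

variable {E : Type*} [NormedAddCommGroup E] [NormedSpace ℝ E]

/-- The partial derivative in the first (time) variable. -/
noncomputable def partialT (Φ : ℝ × ℝ → E) (p : ℝ × ℝ) : E := fderiv ℝ Φ p (1, 0)

/-- The partial derivative in the second (space) variable. -/
noncomputable def partialX (Φ : ℝ × ℝ → E) (p : ℝ × ℝ) : E := fderiv ℝ Φ p (0, 1)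

variable {Φ : ℝ × ℝ → E}

lemma contDiff_partialT (hΦ : ContDiff ℝ (⊤ : ℕ∞) Φ) : ContDiff ℝ (⊤ : ℕ∞) (partialT Φ) :=
  (hΦ.fderiv_right (m := (⊤ : ℕ∞)) (by simp)).clm_apply contDiff_const

lemma contDiff_partialX (hΦ : ContDiff ℝ (⊤ : ℕ∞) Φ) : ContDiff ℝ (⊤ : ℕ∞) (partialX Φ) :=
  (hΦ.fderiv_right (m := (⊤ : ℕ∞)) (by simp)).clm_apply contDiff_const

lemma hasDerivAt_partialT (hΦ : ContDiff ℝ (⊤ : ℕ∞) Φ) (t x : ℝ) :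
    HasDerivAt (fun s => Φ (s, x)) (partialT Φ (t, x)) t :=
  (hΦ.differentiable (by simp) (t, x)).hasFDerivAt.comp_hasDerivAt t
    ((hasDerivAt_id t).prodMk (hasDerivAt_const t x))

lemma hasDerivAt_partialX (hΦ : ContDiff ℝ (⊤ : ℕ∞) Φ) (t x : ℝ) :
    HasDerivAt (fun y => Φ (t, y)) (partialX Φ (t, x)) x :=
  (hΦ.differentiable (by simp) (t, x)).hasFDerivAt.comp_hasDerivAt x
    ((hasDerivAt_const x t).prodMk (hasDerivAt_id x))

lemma partialX_partialT (hΦ : ContDiff ℝ (⊤ : ℕ∞) Φ) (p : ℝ × ℝ) :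
    partialX (partialT Φ) p = partialT (partialX Φ) p := by
  have hd : DifferentiableAt ℝ (fderiv ℝ Φ) p :=
    (hΦ.fderiv_right (m := (⊤ : ℕ∞)) (by simp)).differentiable (by simp) p
  have hs : IsSymmSndFDerivAt ℝ Φ p := hΦ.contDiffAt.isSymmSndFDerivAt
    (by
      rw [minSmoothness_of_isRCLikeNormedField]
      exact WithTop.coe_le_coe.2 (le_top : (2 : ℕ∞) ≤ ⊤))
  have h (v w : ℝ × ℝ) :
      fderiv ℝ (fun q => fderiv ℝ Φ q v) p w = fderiv ℝ (fderiv ℝ Φ) p w v := by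
    rw [fderiv_clm_apply hd (differentiableAt_const v)]
    simp
  change fderiv ℝ (fun q => fderiv ℝ Φ q (1, 0)) p (0, 1) =
    fderiv ℝ (fun q => fderiv ℝ Φ q (0, 1)) p (1, 0)
  rw [h, h, hs.eq]

lemma hasDerivAt_integral_partialT (hΦ : ContDiff ℝ (⊤ : ℕ∞) Φ) (t : ℝ) :
    HasDerivAt (fun s => ∫ x in (0 : ℝ)..(2 * π), Φ (s, x))
      (∫ x in (0 : ℝ)..(2 * π), partialT Φ (t, x)) t := by
  have hc := hΦ.continuous
  have hc' := (contDiff_partialT hΦ).continuous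
  obtain ⟨M, hM⟩ := exists_bound_closedBall_prod_Icc hc' t
  refine (intervalIntegral.hasDerivAt_integral_of_dominated_loc_of_deriv_le
    (F := fun s x => Φ (s, x)) (F' := fun s x => partialT Φ (s, x)) (bound := fun _ => M)
    (Metric.closedBall_mem_nhds t one_pos)
    (.of_forall fun s => Continuous.aestronglyMeasurable (by fun_prop))
    (Continuous.intervalIntegrable (by fun_prop) _ _)
    (Continuous.aestronglyMeasurable (by fun_prop))
    (.of_forall fun x hx s hs => ?_) intervalIntegrable_const
    (.of_forall fun x _ s _ => hasDerivAt_partialT hΦ s x)).2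
  rw [Set.uIoc_of_le two_pi_pos.le] at hx
  exact hM s hs x ⟨hx.1.le, hx.2⟩

end TimeDependence

section TimeDependentMultiplier

variable {Φ : ℝ × ℝ → ℂ}

lemma smoothPeriodic_slice (hΦ : ContDiff ℝ (⊤ : ℕ∞) Φ)
    (hper : ∀ t x, Φ (t, x + 2 * π) = Φ (t, x)) (t : ℝ) : SmoothPeriodic fun y => Φ (t, y) :=
  ⟨hΦ.comp (contDiff_const.prodMk contDiff_id), hper t⟩

lemma partialT_periodic (hΦ : ContDiff ℝ (⊤ : ℕ∞) Φ)
    (hper : ∀ t x, Φ (t, x + 2 * π) = Φ (t, x)) (t x : ℝ) :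
    partialT Φ (t, x + 2 * π) = partialT Φ (t, x) := by
  rw [← (hasDerivAt_partialT hΦ t x).deriv, ← (hasDerivAt_partialT hΦ t (x + 2 * π)).deriv]
  simp_rw [hper]

lemma hasDerivAt_fourierCoef (hΦ : ContDiff ℝ (⊤ : ℕ∞) Φ) (k : ℤ) (t : ℝ) :
    HasDerivAt (fun s => fourierCoef (fun y => Φ (s, y)) k)
      (fourierCoef (fun y => partialT Φ (t, y)) k) t := by
  have he : ContDiff ℝ (⊤ : ℕ∞) fun p : ℝ × ℝ => Complex.exp (-Complex.I * k * p.2) :=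
    (contDiff_const.mul (Complex.ofRealCLM.contDiff.comp contDiff_snd)).cexp
  have h := hasDerivAt_integral_partialT (hΦ.mul he) t
  have hd (x : ℝ) : partialT (fun p => Φ p * Complex.exp (-Complex.I * k * p.2)) (t, x) =
      partialT Φ (t, x) * Complex.exp (-Complex.I * k * x) :=
    (hasDerivAt_partialT (hΦ.mul he) t x).unique
      ((hasDerivAt_partialT hΦ t x).mul_const (Complex.exp (-Complex.I * k * x)))
  simp only [hd] at h
  exact h.const_mul _

lemma hasDerivAt_fourierMul_time (hΦ : ContDiff ℝ (⊤ : ℕ∞) Φ)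
    (hper : ∀ t x, Φ (t, x + 2 * π) = Φ (t, x)) {m : ℤ → ℂ} (hm : ∀ k, ‖m k‖ ≤ 1) (t x : ℝ) :
    HasDerivAt (fun s => fourierMul m (fun y => Φ (s, y)) x)
      (fourierMul m (fun y => partialT Φ (t, y)) x) t := by
  have hΦ' := contDiff_partialT hΦ
  have hΦ'' := contDiff_partialX (contDiff_partialX hΦ')
  obtain ⟨A, hA⟩ := exists_bound_closedBall_prod_Icc hΦ'.continuous t
  obtain ⟨B, hB⟩ := exists_bound_closedBall_prod_Icc hΦ''.continuous t
  have hdd (s : ℝ) : deriv (deriv fun y => partialT Φ (s, y)) =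
      fun y => partialX (partialX (partialT Φ)) (s, y) := by
    rw [show deriv (fun y => partialT Φ (s, y)) = fun y => partialX (partialT Φ) (s, y) from
      funext fun y => (hasDerivAt_partialX hΦ' s y).deriv]
    exact funext fun y => (hasDerivAt_partialX (contDiff_partialX hΦ') s y).deriv
  refine hasDerivAt_tsum_of_isPreconnected (t := Metric.ball t 1)
    (summable_decayBound (max A B)) Metric.isOpen_ball
    (convex_ball t 1).isPreconnected
    (fun k s _ => ((hasDerivAt_fourierCoef hΦ k s).const_mul (m k)).mul_const _)
    (fun k s hs => norm_fourierMul_term_le hm ?_ x) (Metric.mem_ball_self one_pos)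
    ((smoothPeriodic_slice hΦ hper t).summable_fourierMul hm x) (Metric.mem_ball_self one_pos)
  have hs' := Metric.ball_subset_closedBall hs
  refine (smoothPeriodic_slice hΦ' (partialT_periodic hΦ hper) s).norm_fourierCoef_le_decayBound
    (fun y hy => (hA s hs' y hy).trans (le_max_left _ _)) (fun y hy => ?_) k
  rw [hdd]
  exact (hB s hs' y hy).trans (le_max_right _ _)

end TimeDependentMultiplier

section RealHilbert

variable {f : ℝ → ℝ}

lemma smoothPeriodic_ofReal (hf : ContDiff ℝ (⊤ : ℕ∞) f) (hper : Function.Periodic f (2 * π)) :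
    SmoothPeriodic fun y => (f y : ℂ) :=
  ⟨Complex.ofRealCLM.contDiff.comp hf, fun x => congrArg Complex.ofReal (hper x)⟩

lemma deriv_ofReal_comp (hf : Differentiable ℝ f) :
    deriv (fun y => (f y : ℂ)) = fun y => ((deriv f y : ℝ) : ℂ) :=
  funext fun y => (hf y).hasDerivAt.ofReal_comp.deriv

lemma hasDerivAt_hilbertR (hf : ContDiff ℝ (⊤ : ℕ∞) f) (hper : Function.Periodic f (2 * π))
    (x : ℝ) : HasDerivAt (hilbertR f) (hilbertR (deriv f) x) x := by
  have h := (smoothPeriodic_ofReal hf hper).hasDerivAt_fourierMul norm_hilbert_symbol_le x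
  rw [deriv_ofReal_comp (hf.differentiable (by simp)), ← hilbertC_eq_fourierMul] at h
  exact Complex.reCLM.hasFDerivAt.comp_hasDerivAt x h

lemma hilbertR_periodic (f : ℝ → ℝ) : Function.Periodic (hilbertR f) (2 * π) := fun x =>
  congrArg Complex.re (fourierMul_periodic _ _ x)

lemma deriv_periodic (hper : Function.Periodic f (2 * π)) :
    Function.Periodic (deriv f) (2 * π) := fun x => by
  rw [← deriv_comp_add_const, show (fun x => f (x + 2 * π)) = f from funext hper]

lemma continuous_hilbertR (hf : ContDiff ℝ (⊤ : ℕ∞) f) (hper : Function.Periodic f (2 * π)) :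
    Continuous (hilbertR f) :=
  continuous_iff_continuousAt.2 fun x => (hasDerivAt_hilbertR hf hper x).continuousAt

lemma integral_hilbertR_deriv (hf : ContDiff ℝ (⊤ : ℕ∞) f) (hper : Function.Periodic f (2 * π)) :
    ∫ x in (0 : ℝ)..(2 * π), hilbertR (deriv f) x = 0 := by
  have hc := continuous_hilbertR (contDiff_infty_iff_deriv.1 hf).2 (deriv_periodic hper)
  rw [intervalIntegral.integral_eq_sub_of_hasDerivAt
    (fun x _ => hasDerivAt_hilbertR hf hper x) (hc.intervalIntegrable _ _), sub_eq_zero]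
  simpa using hilbertR_periodic f 0

end RealHilbert

/-- The equation satisfied by the primitive `F` of `u`, obtained by integrating in space. -/
lemma primitive_equation {u g F G : ℝ → ℝ → ℝ} {t : ℝ}
    (hu : ContDiff ℝ (⊤ : ℕ∞) (fun p : ℝ × ℝ => u p.1 p.2))
    (huper : ∀ t x : ℝ, u t (x + 2 * π) = u t x)
    (hF : ContDiff ℝ (⊤ : ℕ∞) (fun p : ℝ × ℝ => F p.1 p.2))
    (hFderiv : ∀ t x : ℝ, deriv (F t) x = u t x)
    (hFmean : ∀ t : ℝ, ∫ x in (0:ℝ)..(2 * π), F t x = 0)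
    (hG : ContDiff ℝ (⊤ : ℕ∞) (fun p : ℝ × ℝ => G p.1 p.2))
    (hGderiv : ∀ t x : ℝ, deriv (G t) x = g t x)
    (hGmean : ∀ t : ℝ, ∫ x in (0:ℝ)..(2 * π), G t x = 0)
    (hPDE : ∀ x : ℝ, deriv (fun s => u s x) t + hilbertR (iteratedDeriv 2 (u t)) x
        + u t x * deriv (u t) x = g t x) (x : ℝ) :
    partialT (fun p : ℝ × ℝ => F p.1 p.2) (t, x) + hilbertR (deriv (u t)) x + u t x ^ 2 / 2
      - G t x = (1 / (4 * π)) * ∫ z in (0:ℝ)..(2 * π), u t z ^ 2 := by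
  have hFT := contDiff_partialT hF
  have hut : ContDiff ℝ (⊤ : ℕ∞) (u t) := hu.comp (contDiff_const.prodMk contDiff_id)
  have hGt : ContDiff ℝ (⊤ : ℕ∞) (G t) := hG.comp (contDiff_const.prodMk contDiff_id)
  have hut' := (contDiff_infty_iff_deriv.1 hut).2
  have hut'per := deriv_periodic (huper t)
  set q : ℝ → ℝ := fun y => partialT (fun p : ℝ × ℝ => F p.1 p.2) (t, y)
    + hilbertR (deriv (u t)) y + u t y ^ 2 / 2 - G t y with hq
  have hFX : partialX (fun p : ℝ × ℝ => F p.1 p.2) = fun p => u p.1 p.2 := by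
    ext ⟨s, y⟩
    exact (hasDerivAt_partialX hF s y).deriv.symm.trans (hFderiv s y)
  have hqd (y : ℝ) : HasDerivAt q 0 y := by
    have h1 := hasDerivAt_partialX hFT t y
    rw [partialX_partialT hF, hFX, ← (hasDerivAt_partialT hu t y).deriv] at h1
    have h2 := hasDerivAt_hilbertR hut' hut'per y
    have h3 := (((hut.differentiable (by simp) y).hasDerivAt.pow 2).div_const 2)
    have h4 := (hGt.differentiable (by simp) y).hasDerivAt
    refine (((h1.add h2).add h3).sub h4).congr_deriv ?_
    have h := hPDE y
    rw [iteratedDeriv_succ, iteratedDeriv_one] at h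
    rw [hGderiv]
    push_cast
    linear_combination h
  have hconst (y : ℝ) : q y = q x :=
    is_const_of_deriv_eq_zero (fun z => (hqd z).differentiableAt) (fun z => (hqd z).deriv) y x
  have hFT0 : ∫ y in (0:ℝ)..(2 * π), partialT (fun p : ℝ × ℝ => F p.1 p.2) (t, y) = 0 := by
    have h := hasDerivAt_integral_partialT hF t
    simp only [hFmean] at h
    exact h.unique (hasDerivAt_const t 0)
  have c1 : Continuous fun y => partialT (fun p : ℝ × ℝ => F p.1 p.2) (t, y) :=
    hFT.continuous.comp (by fun_prop)
  have c2 := continuous_hilbertR hut' hut'per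
  have c3 : Continuous fun y => u t y ^ 2 / 2 := (hut.continuous.pow 2).div_const 2
  have c12 : Continuous fun y =>
      partialT (fun p : ℝ × ℝ => F p.1 p.2) (t, y) + hilbertR (deriv (u t)) y := c1.add c2
  have c123 : Continuous fun y => partialT (fun p : ℝ × ℝ => F p.1 p.2) (t, y)
      + hilbertR (deriv (u t)) y + u t y ^ 2 / 2 := c12.add c3
  have hi : ∫ y in (0:ℝ)..(2 * π), q y = (∫ y in (0:ℝ)..(2 * π), u t y ^ 2) / 2 := by
    simp only [hq]
    rw [intervalIntegral.integral_sub (c123.intervalIntegrable _ _)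
      (hGt.continuous.intervalIntegrable _ _),
      intervalIntegral.integral_add (c12.intervalIntegrable _ _)
        (c3.intervalIntegrable _ _),
      intervalIntegral.integral_add (c1.intervalIntegrable _ _) (c2.intervalIntegrable _ _),
      hFT0, integral_hilbertR_deriv hut (huper t), hGmean, intervalIntegral.integral_div]
    ring
  simp only [hconst, intervalIntegral.integral_const, sub_zero, smul_eq_mul] at hi
  change q x = _
  generalize (∫ z in (0:ℝ)..(2 * π), u t z ^ 2) = A at hi ⊢
  field_simp
  linear_combination 2 * hi

/-- **Equation for the gauge transform.** If `u` solves `∂ₜu + H∂ₓ²u + u∂ₓu = g` on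
`[0,T] × ℝ` (both smooth, `2π`-periodic and of zero mean in `x`), `F(t,·)`, `G(t,·)` are the
zero-mean `2π`-periodic antiderivatives of `u(t,·)`, `g(t,·)`, and `W = P₊(e^{iF/2})`, then
`∂ₜW − i∂ₓ²W = (i/2) P₊[e^{iF/2}((1/4π)∫₀^{2π}(∂ₓF)² dy + G − 2i P₋∂ₓu)]` pointwise. -/
theorem gauge_transform_equation (T : ℝ) (hT : 0 < T) (u g F G : ℝ → ℝ → ℝ)
    (W : ℝ → ℝ → ℂ)
    (hu : ContDiff ℝ (⊤ : ℕ∞) (fun p : ℝ × ℝ => u p.1 p.2))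
    (hg : ContDiff ℝ (⊤ : ℕ∞) (fun p : ℝ × ℝ => g p.1 p.2))
    (huper : ∀ t x : ℝ, u t (x + 2 * π) = u t x)
    (hgper : ∀ t x : ℝ, g t (x + 2 * π) = g t x)
    (humean : ∀ t : ℝ, ∫ x in (0:ℝ)..(2 * π), u t x = 0)
    (hgmean : ∀ t : ℝ, ∫ x in (0:ℝ)..(2 * π), g t x = 0)
    (hF : ContDiff ℝ (⊤ : ℕ∞) (fun p : ℝ × ℝ => F p.1 p.2))
    (hFper : ∀ t x : ℝ, F t (x + 2 * π) = F t x)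
    (hFderiv : ∀ t x : ℝ, deriv (F t) x = u t x)
    (hFmean : ∀ t : ℝ, ∫ x in (0:ℝ)..(2 * π), F t x = 0)
    (hG : ContDiff ℝ (⊤ : ℕ∞) (fun p : ℝ × ℝ => G p.1 p.2))
    (hGper : ∀ t x : ℝ, G t (x + 2 * π) = G t x)
    (hGderiv : ∀ t x : ℝ, deriv (G t) x = g t x)
    (hGmean : ∀ t : ℝ, ∫ x in (0:ℝ)..(2 * π), G t x = 0)
    (hW : ∀ t x : ℝ, W t x = Pplus (fun y => Complex.exp (Complex.I * F t y / 2)) x)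
    (hPDE : ∀ t ∈ Set.Icc (0:ℝ) T, ∀ x : ℝ,
      deriv (fun s => u s x) t + hilbertR (iteratedDeriv 2 (u t)) x
        + u t x * deriv (u t) x = g t x) :
    ∀ t ∈ Set.Icc (0:ℝ) T, ∀ x : ℝ,
      deriv (fun s => W s x) t - Complex.I * iteratedDeriv 2 (W t) x
      = (Complex.I / 2) *
          Pplus (fun y =>
            Complex.exp (Complex.I * F t y / 2) *
              (((1 / (4 * π)) * ∫ z in (0:ℝ)..(2 * π), (deriv (F t) z) ^ 2 : ℝ)
                + (G t y : ℂ)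
                - 2 * Complex.I * Pminus (fun z => ((deriv (u t) z : ℝ) : ℂ)) y)) x := by
  intro t ht x
  have hslice {v : ℝ → ℝ → ℝ} (hv : ContDiff ℝ (⊤ : ℕ∞) (fun p : ℝ × ℝ => v p.1 p.2)) (s : ℝ) :
      ContDiff ℝ (⊤ : ℕ∞) (v s) := hv.comp (contDiff_const.prodMk contDiff_id)
  have hdu : deriv (F t) = u t := funext (hFderiv t)
  set Φ : ℝ × ℝ → ℂ := fun p => Complex.exp (Complex.I * F p.1 p.2 / 2) with hΦdef
  have hΦ : ContDiff ℝ (⊤ : ℕ∞) Φ :=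
    ((contDiff_const.mul (Complex.ofRealCLM.contDiff.comp hF)).div_const 2).cexp
  have hΦper (s y : ℝ) : Φ (s, y + 2 * π) = Φ (s, y) := by simp only [hΦdef, hFper]
  have hf := smoothPeriodic_slice hΦ hΦper t
  have hΦT (y : ℝ) : partialT Φ (t, y) =
      Complex.I / 2 * (partialT (fun p : ℝ × ℝ => F p.1 p.2) (t, y) : ℝ) * Φ (t, y) := by
    refine (hasDerivAt_partialT hΦ t y).unique ?_
    refine (((hasDerivAt_partialT hF t y).ofReal_comp.const_mul
      Complex.I).div_const 2).cexp.congr_deriv ?_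
    ring
  have hf' : deriv (fun y => Φ (t, y)) = fun y => Complex.I / 2 * (u t y : ℂ) * Φ (t, y) := by
    ext y
    have h : HasDerivAt (F t) (u t y) y :=
      hFderiv t y ▸ ((hslice hF t).differentiable (by simp) y).hasDerivAt
    refine ((h.ofReal_comp.const_mul Complex.I).div_const 2).cexp.deriv.trans ?_
    ring
  have hf'' (y : ℝ) : deriv (deriv fun y => Φ (t, y)) y = Complex.I / 2 *
      (((deriv (u t) y : ℝ) : ℂ) + Complex.I / 2 * (u t y : ℂ) ^ 2) * Φ (t, y) := by
    have h : HasDerivAt (u t) (deriv (u t) y) y :=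
      ((hslice hu t).differentiable (by simp) y).hasDerivAt
    have h' := (h.ofReal_comp.const_mul (Complex.I / 2)).mul (hf.hasDerivAt y)
    rw [hf'] at h' ⊢
    refine h'.deriv.trans ?_
    ring
  have hu' := smoothPeriodic_ofReal (hslice hu t) (huper t)
  have hu'_deriv := deriv_ofReal_comp ((hslice hu t).differentiable (by simp))
  have hint := primitive_equation hu huper hF hFderiv hFmean hG hGderiv hGmean
    (hPDE t ht)
  have hWt : deriv (fun s => W s x) t = Pplus (fun y => partialT Φ (t, y)) x := by
    simp_rw [hW, Pplus_eq_fourierMul]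
    exact (hasDerivAt_fourierMul_time hΦ hΦper norm_Pplus_symbol_le t x).deriv
  have hWx : iteratedDeriv 2 (W t) x = Pplus (deriv (deriv fun y => Φ (t, y))) x := by
    rw [iteratedDeriv_succ, iteratedDeriv_one, show W t = _ from funext (hW t),
      Pplus_eq_fourierMul, show deriv (fourierMul _ fun y => Φ (t, y)) = _ from
        funext fun y => (hf.hasDerivAt_fourierMul norm_Pplus_symbol_le y).deriv]
    exact (hf.deriv.hasDerivAt_fourierMul norm_Pplus_symbol_le x).deriv
  have hT' := smoothPeriodic_slice (contDiff_partialT hΦ) (partialT_periodic hΦ hΦper) t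
  rw [hWt, hWx, Pplus_eq_fourierMul, ← fourierMul_const_mul, ← fourierMul_const_mul,
    ← hT'.fourierMul_sub (hf.deriv.deriv.const_mul _) norm_Pplus_symbol_le]
  congr 1
  ext y
  have hmean : fourierCoef (fun z => ((deriv (u t) z : ℝ) : ℂ)) 0 = 0 := by
    rw [← hu'_deriv, hu'.fourierCoef_deriv]
    simp
  have hP := (hu'_deriv ▸ hu'.deriv).two_I_mul_Pminus hmean y
  rw [← ofReal_hilbertR] at hP
  have hint' := congrArg Complex.ofReal (hint y)
  rw [hP, hΦT, hf'', hdu, ← hint']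
  push_cast
  linear_combination (-(1 / 4 : ℂ) * Complex.I * (u t y : ℂ) ^ 2 * Φ (t, y)) * Complex.I_sq
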